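/- Let μ and ν be Borel probability measures on ℝ with finite second moments and quantile functions Q_μ, Q_ν. Then for every coupling γ of μ and ν (i.e., every probability measure γ on ℝ × ℝ whose first and second marginals are μ and ν), one has ∫_{ℝ×ℝ} (x − y)² dγ(x,y) ≥ ∫₀¹ (Q_μ(t) − Q_ν(t))² dt. -/

import Mathlib

open MeasureTheory Set

/-- Cumulative distribution function of a measure on ℝ: `F_μ(x) = μ((−∞, x])`. -/
noncomputable def cdfFn (μ : Measure ℝ) (x : ℝ) : ℝ := (μ (Iic x)).toReal

/-- Quantile function of a measure on ℝ: `Q_μ(t) = inf {x | t ≤ F_μ(x)}`. -/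
noncomputable def quantileFn (μ : Measure ℝ) (t : ℝ) : ℝ := sInf {x : ℝ | t ≤ cdfFn μ x}

/-- The one-dimensional Wasserstein-2 distance between measures on ℝ, given in closed form
via quantile functions: `W(μ,ν) = (∫₀¹ (Q_μ(t) − Q_ν(t))² dt)^{1/2}`. -/
noncomputable def W2 (μ ν : Measure ℝ) : ℝ :=
  Real.sqrt (∫ t in Ioo (0 : ℝ) 1, (quantileFn μ t - quantileFn ν t) ^ 2)

/-- The squared distance is the total area of the two squares `[x, y)²` and `[y, x)²`, one of
which is empty. -/
lemma ofReal_sub_sq_eq_volume (x y : ℝ) :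
    ENNReal.ofReal ((x - y) ^ 2)
      = volume (Ico x y ×ˢ Ico x y) + volume (Ico y x ×ˢ Ico y x) := by
  simp only [Measure.volume_eq_prod, Measure.prod_prod, Real.volume_Ico]
  rcases le_total x y with h | h
  · rw [ENNReal.ofReal_of_nonpos (sub_nonpos.2 h), ← ENNReal.ofReal_mul (sub_nonneg.2 h),
      mul_zero, add_zero]
    congr 1
    ring
  · rw [ENNReal.ofReal_of_nonpos (sub_nonpos.2 h), ← ENNReal.ofReal_mul (sub_nonneg.2 h),
      mul_zero, zero_add]
    congr 1
    ring

lemma mem_Ico_prod_self_iff {x y : ℝ} {w : ℝ × ℝ} :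
    w ∈ Ico x y ×ˢ Ico x y ↔ x ≤ min w.1 w.2 ∧ max w.1 w.2 < y := by
  simp only [mem_prod, mem_Ico, le_min_iff, max_lt_iff]
  tauto

/-- Layer-cake formula for the area of the random square `[f, g)²`. -/
lemma lintegral_volume_Ico_prod_self {Ω : Type*} [MeasurableSpace Ω] (P : Measure Ω) [SFinite P]
    {f g : Ω → ℝ} (hf : AEMeasurable f P) (hg : AEMeasurable g P) :
    ∫⁻ ω, volume (Ico (f ω) (g ω) ×ˢ Ico (f ω) (g ω)) ∂P
      = ∫⁻ w : ℝ × ℝ, P {ω | f ω ≤ min w.1 w.2 ∧ max w.1 w.2 < g ω} := by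
  wlog h : Measurable f ∧ Measurable g generalizing f g
  · have key := this hf.measurable_mk.aemeasurable hg.measurable_mk.aemeasurable
      ⟨hf.measurable_mk, hg.measurable_mk⟩
    convert key using 1
    · apply lintegral_congr_ae
      filter_upwards [hf.ae_eq_mk, hg.ae_eq_mk] with ω h₁ h₂
      rw [h₁, h₂]
    · refine lintegral_congr fun w => measure_congr ?_
      filter_upwards [hf.ae_eq_mk, hg.ae_eq_mk] with ω h₁ h₂
      apply propext
      change (f ω ≤ _ ∧ _ < g ω) ↔ (hf.mk f ω ≤ _ ∧ _ < hg.mk g ω)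
      rw [h₁, h₂]
  obtain ⟨hf', hg'⟩ := h
  have hS : MeasurableSet
      {p : Ω × (ℝ × ℝ) | f p.1 ≤ min p.2.1 p.2.2 ∧ max p.2.1 p.2.2 < g p.1} := by
    rw [ofPred_and]
    refine (measurableSet_le ?_ ?_).inter (measurableSet_lt ?_ ?_) <;> fun_prop
  have h₁ := Measure.prod_apply (μ := P) (ν := (volume : Measure (ℝ × ℝ))) hS
  rw [Measure.prod_apply_symm hS] at h₁
  refine Eq.trans ?_ h₁.symm
  refine lintegral_congr fun ω => congrArg _ ?_
  ext w
  exact mem_Ico_prod_self_iff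

lemma lintegral_ofReal_sub_sq {Ω : Type*} [MeasurableSpace Ω] (P : Measure Ω) [SFinite P]
    {f g : Ω → ℝ} (hf : AEMeasurable f P) (hg : AEMeasurable g P) :
    ∫⁻ ω, ENNReal.ofReal ((f ω - g ω) ^ 2) ∂P
      = (∫⁻ w : ℝ × ℝ, P {ω | f ω ≤ min w.1 w.2 ∧ max w.1 w.2 < g ω})
        + ∫⁻ w : ℝ × ℝ, P {ω | g ω ≤ min w.1 w.2 ∧ max w.1 w.2 < f ω} := by
  have hm : AEMeasurable (fun ω => volume (Ico (f ω) (g ω) ×ˢ Ico (f ω) (g ω))) P := by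
    simp only [Measure.volume_eq_prod, Measure.prod_prod, Real.volume_Ico]
    fun_prop
  simp only [ofReal_sub_sq_eq_volume]
  rw [lintegral_add_left' hm, lintegral_volume_Ico_prod_self P hf hg,
    lintegral_volume_Ico_prod_self P hg hf]

lemma cdfFn_eq_cdf (μ : Measure ℝ) [IsProbabilityMeasure μ] (x : ℝ) :
    cdfFn μ x = ProbabilityTheory.cdf μ x := by
  rw [ProbabilityTheory.cdf_eq_real]
  rfl

lemma exists_le_cdfFn (μ : Measure ℝ) [IsProbabilityMeasure μ] {t : ℝ} (ht : t < 1) :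
    ∃ x, t ≤ cdfFn μ x := by
  simp only [cdfFn_eq_cdf]
  exact ((ProbabilityTheory.tendsto_cdf_atTop μ).eventually_const_le ht).exists

lemma bddBelow_le_cdfFn (μ : Measure ℝ) [IsProbabilityMeasure μ] {t : ℝ} (ht : 0 < t) :
    BddBelow {x | t ≤ cdfFn μ x} := by
  simp only [cdfFn_eq_cdf]
  obtain ⟨a, ha⟩ := ((ProbabilityTheory.tendsto_cdf_atBot μ).eventually_lt_const ht).exists
  refine ⟨a, fun x hx => le_of_lt ?_⟩
  exact (ProbabilityTheory.monotone_cdf μ).reflect_lt (ha.trans_le hx)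

/-- On `(0, 1)` the quantile function is the lower adjoint of the distribution function. -/
lemma quantileFn_le_iff (μ : Measure ℝ) [IsProbabilityMeasure μ] {t : ℝ} (ht : t ∈ Ioo (0 : ℝ) 1)
    (x : ℝ) : quantileFn μ t ≤ x ↔ t ≤ cdfFn μ x := by
  refine ⟨fun h => ?_, fun h => csInf_le (bddBelow_le_cdfFn μ ht.1) h⟩
  have hright : Filter.Tendsto (cdfFn μ) (nhdsWithin x (Ioi x)) (nhds (cdfFn μ x)) := by
    simp only [funext (cdfFn_eq_cdf μ)]
    exact ((ProbabilityTheory.cdf μ).right_continuous x).mono Ioi_subset_Ici_self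
  refine ge_of_tendsto hright ?_
  filter_upwards [self_mem_nhdsWithin] with y hy
  obtain ⟨z, hz, hzy⟩ := exists_lt_of_csInf_lt (exists_le_cdfFn μ ht.2) (h.trans_lt hy)
  refine le_trans hz ?_
  rw [cdfFn_eq_cdf, cdfFn_eq_cdf]
  exact ProbabilityTheory.monotone_cdf μ hzy.le

lemma aemeasurable_quantileFn (μ : Measure ℝ) [IsProbabilityMeasure μ] :
    AEMeasurable (quantileFn μ) (volume.restrict (Ioo (0 : ℝ) 1)) := by
  refine aemeasurable_restrict_of_monotoneOn measurableSet_Ioo fun s hs t ht hst => ?_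
  rw [quantileFn_le_iff μ hs]
  exact hst.trans ((quantileFn_le_iff μ ht _).1 le_rfl)

/-- Among all couplings, the quantile coupling gives the least mass to each quadrant
`(-∞, u] × (v, ∞)`. -/
lemma volume_quantileFn_quadrant_le {Ω : Type*} [MeasurableSpace Ω] (P : Measure Ω)
    [IsProbabilityMeasure P] {X Y : Ω → ℝ} (hX : Measurable X) (hY : Measurable Y)
    [IsProbabilityMeasure (P.map X)] [IsProbabilityMeasure (P.map Y)] (u v : ℝ) :
    volume.restrict (Ioo (0 : ℝ) 1) {t | quantileFn (P.map X) t ≤ u ∧ v < quantileFn (P.map Y) t}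
      ≤ P {ω | X ω ≤ u ∧ v < Y ω} := by
  have hsub : {t | quantileFn (P.map X) t ≤ u ∧ v < quantileFn (P.map Y) t} ∩ Ioo 0 1
      ⊆ Ioc (cdfFn (P.map Y) v) (cdfFn (P.map X) u) := by
    rintro t ⟨⟨h₁, h₂⟩, ht⟩
    rw [← not_le, quantileFn_le_iff _ ht, not_le] at h₂
    exact ⟨h₂, (quantileFn_le_iff _ ht _).1 h₁⟩
  rw [Measure.restrict_apply' measurableSet_Ioo]
  refine (measure_mono hsub).trans ?_
  rw [Real.volume_Ioc, cdfFn, cdfFn, ENNReal.ofReal_sub _ ENNReal.toReal_nonneg,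
    ENNReal.ofReal_toReal (measure_ne_top _ _), ENNReal.ofReal_toReal (measure_ne_top _ _),
    Measure.map_apply hX measurableSet_Iic, Measure.map_apply hY measurableSet_Iic]
  refine le_measure_sdiff.trans (measure_mono ?_)
  rintro ω ⟨h₁, h₂⟩
  exact ⟨h₁, not_le.1 h₂⟩

/-- Optimality of the quantile coupling: every coupling `γ` of `μ` and `ν` has quadratic
transport cost at least `∫₀¹ (Q_μ(t) − Q_ν(t))² dt`. -/
theorem coupling_cost_ge_quantile_cost (μ ν : Measure ℝ)
    [IsProbabilityMeasure μ] [IsProbabilityMeasure ν]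
    (hμ : Integrable (fun x : ℝ => x ^ 2) μ) (hν : Integrable (fun x : ℝ => x ^ 2) ν)
    (γ : Measure (ℝ × ℝ)) [IsProbabilityMeasure γ]
    (hfst : Measure.map Prod.fst γ = μ) (hsnd : Measure.map Prod.snd γ = ν) :
    (∫⁻ t in Ioo (0 : ℝ) 1, ENNReal.ofReal ((quantileFn μ t - quantileFn ν t) ^ 2))
      ≤ ∫⁻ p : ℝ × ℝ, ENNReal.ofReal ((p.1 - p.2) ^ 2) ∂γ := by
  rw [lintegral_ofReal_sub_sq _ (aemeasurable_quantileFn μ) (aemeasurable_quantileFn ν),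
    lintegral_ofReal_sub_sq γ measurable_fst.aemeasurable measurable_snd.aemeasurable]
  subst hfst hsnd
  exact add_le_add
    (lintegral_mono fun w =>
      volume_quantileFn_quadrant_le γ measurable_fst measurable_snd _ _)
    (lintegral_mono fun w =>
      volume_quantileFn_quadrant_le γ measurable_snd measurable_fst _ _)
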